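/- Define a_0 = 20, a_j = 2^{a_{j−1}} for j ≥ 1, and E_j = (a_j)². Define ℓ_1 = E_1, ℓ_j = 4E_jE_{j−2}/E_{j−1} and b_j = E_j/E_{j−1} for j ≥ 2, L_1 = ℓ_1, and L_j = ℓ_j + ∑_{k=1}^{j−1} b_j b_{j−1} ⋯ b_{k+1} ℓ_k for j ≥ 2. Let ε_0 := 4 ∑_{k=2}^∞ E_{k−2}/E_{k−1} (a convergent series). Then for every j ≥ 1, E_j ≤ L_j ≤ (1 + ε_0) E_j. -/

import Mathlib

/-- The sequence `a_0 = 20`, `a_j = 2^{a_{j-1}}`. -/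
def a : ℕ → ℕ
  | 0 => 20
  | j + 1 => 2 ^ a j

/-- `E_j = (a_j)²`. -/
def E (j : ℕ) : ℕ := a j ^ 2

/-- `ℓ_1 = E_1` and `ℓ_j = 4 E_j E_{j-2} / E_{j-1}` for `j ≥ 2`, as reals. -/
noncomputable def ell (j : ℕ) : ℝ :=
  if j = 1 then (E 1 : ℝ) else 4 * (E j : ℝ) * (E (j - 2) : ℝ) / (E (j - 1) : ℝ)

/-- `b_j = E_j / E_{j-1}`, as a real. -/
noncomputable def b (j : ℕ) : ℝ := (E j : ℝ) / (E (j - 1) : ℝ)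

/-- `L_j = ℓ_j + ∑_{k=1}^{j-1} b_j b_{j-1} ⋯ b_{k+1} ℓ_k` (so `L_1 = ℓ_1`). -/
noncomputable def Lb (j : ℕ) : ℝ :=
  ell j + ∑ k ∈ Finset.Icc 1 (j - 1), (∏ i ∈ Finset.Icc (k + 1) j, b i) * ell k

/-- `ε₀ = 4 ∑_{k=2}^∞ E_{k-2}/E_{k-1}`, written as `4 ∑_{k=0}^∞ E_k/E_{k+1}`. -/
noncomputable def eps0 : ℝ := 4 * ∑' k : ℕ, (E k : ℝ) / (E (k + 1) : ℝ)

lemma four_le_a (j : ℕ) : 4 ≤ a j := by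
  induction j with
  | zero => simp [a]
  | succ j ih => exact ih.trans Nat.lt_two_pow_self.le

lemma le_a (j : ℕ) : j ≤ a j := by
  induction j with
  | zero => exact Nat.zero_le _
  | succ j ih => exact ih.trans_lt Nat.lt_two_pow_self

lemma sq_le_two_pow {n : ℕ} (hn : 4 ≤ n) : n ^ 2 ≤ 2 ^ n := by
  induction n, hn using Nat.le_induction with
  | base => norm_num
  | succ n hn ih => rw [pow_succ 2 n]; nlinarith

lemma E_pos (j : ℕ) : (0 : ℝ) < E j := by
  have := four_le_a j
  exact_mod_cast pow_pos (by omega : 0 < a j) 2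

lemma E_mul_two_pow_le (j : ℕ) : E j * 2 ^ j ≤ E (j + 1) :=
  calc E j * 2 ^ j ≤ 2 ^ a j * 2 ^ a j :=
        Nat.mul_le_mul (sq_le_two_pow (four_le_a j)) (Nat.pow_le_pow_right two_pos (le_a j))
    _ = E (j + 1) := (sq _).symm

lemma summable_E_div_E_succ : Summable (fun k : ℕ => (E k : ℝ) / (E (k + 1) : ℝ)) := by
  refine Summable.of_nonneg_of_le (fun k => by positivity) (fun k => ?_) summable_geometric_two
  rw [div_le_iff₀ (E_pos _), one_div, inv_pow, inv_mul_eq_div, le_div_iff₀ (by positivity)]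
  exact_mod_cast E_mul_two_pow_le k

lemma Lb_one : Lb 1 = E 1 := by
  simp [Lb, ell]

lemma Lb_add_two (n : ℕ) : Lb (n + 2) = ell (n + 2) + b (n + 2) * Lb (n + 1) := by
  have h : ∀ k ∈ Finset.Icc 1 n, (∏ i ∈ Finset.Icc (k + 1) (n + 2), b i) * ell k =
      b (n + 2) * ((∏ i ∈ Finset.Icc (k + 1) (n + 1), b i) * ell k) := by
    intro k hk
    rw [Finset.prod_Icc_succ_top (by grind)]
    ring
  rw [Lb, Lb, show n + 2 - 1 = n + 1 from rfl, Nat.add_sub_cancel,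
    Finset.sum_Icc_succ_top (by omega), Finset.sum_congr rfl h, ← Finset.mul_sum,
    Finset.Icc_self, Finset.prod_singleton]
  ring

lemma Lb_succ_eq (n : ℕ) :
    Lb (n + 1) = E (n + 1) * (1 + 4 * ∑ k ∈ Finset.range n, (E k : ℝ) / (E (k + 1) : ℝ)) := by
  induction n with
  | zero => simp [Lb_one]
  | succ n ih =>
    have h := (E_pos (n + 1)).ne'
    rw [Lb_add_two, ih, Finset.sum_range_succ, ell, b, if_neg (by omega),
      show n + 2 - 1 = n + 1 from rfl, Nat.add_sub_cancel]
    field_simp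
    ring

/-- The series defining `ε₀` converges, and for every
`j ≥ 1`, `E_j ≤ L_j ≤ (1 + ε₀) E_j`. -/
theorem E_le_L_le :
    Summable (fun k : ℕ => (E k : ℝ) / (E (k + 1) : ℝ)) ∧
    ∀ j : ℕ, 1 ≤ j → (E j : ℝ) ≤ Lb j ∧ Lb j ≤ (1 + eps0) * (E j : ℝ) := by
  refine ⟨summable_E_div_E_succ, fun j hj => ?_⟩
  obtain ⟨n, rfl⟩ := Nat.exists_eq_add_of_le' hj
  have hE := E_pos (n + 1)
  have h0 : 0 ≤ ∑ k ∈ Finset.range n, (E k : ℝ) / (E (k + 1) : ℝ) :=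
    Finset.sum_nonneg fun k _ => by positivity
  have h1 : ∑ k ∈ Finset.range n, (E k : ℝ) / (E (k + 1) : ℝ) ≤
      ∑' k : ℕ, (E k : ℝ) / (E (k + 1) : ℝ) :=
    summable_E_div_E_succ.sum_le_tsum _ fun k _ => by positivity
  rw [Lb_succ_eq]
  refine ⟨le_mul_of_one_le_right hE.le (by linarith), ?_⟩
  rw [mul_comm, eps0]
  gcongr
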